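/- Let n ≥ 3 be an integer, p ∈ ℝⁿ, r > 0, and let h = (h_{ij}) : ℝⁿ → ℝ^{n×n} be continuously differentiable on a neighborhood of the sphere S_r(p) = {x : |x − p| = r}. Write ρ(x) = (x − p)/r and let Hⁿ⁻¹ denote (n−1)-dimensional Hausdorff measure. Then for each l ∈ {1, …, n}: ∫_{S_r(p)} (x_l − p_l) Σ_{i,j,k} ∂_k h_{ij}(x) ρ_i(x) ρ_j(x) ρ_k(x) dHⁿ⁻¹(x) = ∫_{S_r(p)} [ Σ_i h_{il}(x) ρ_i(x) + (x_l − p_l) ( r^{−1} Σ_i h_{ii}(x) − (n+1) r^{−1} Σ_{i,j} h_{ij}(x) ρ_i(x) ρ_j(x) + Σ_{i,j} ∂_j h_{ij}(x) ρ_i(x) ) ] dHⁿ⁻¹(x). -/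

import Mathlib

open MeasureTheory

section

variable {E : Type*} [NormedAddCommGroup E] [InnerProductSpace ℝ E]

/-- Rotation by the angle `t` in the plane spanned by two orthonormal vectors. -/
noncomputable def planeRotation (u v : E) (t : ℝ) : E →ₗ[ℝ] E :=
  LinearMap.id
    + (((Real.cos t - 1) • innerₛₗ ℝ u - Real.sin t • innerₛₗ ℝ v).smulRight u
      + (Real.sin t • innerₛₗ ℝ u + (Real.cos t - 1) • innerₛₗ ℝ v).smulRight v)

theorem planeRotation_apply (u v : E) (t : ℝ) (x : E) :
    planeRotation u v t x = x
      + (((Real.cos t - 1) * inner ℝ u x - Real.sin t * inner ℝ v x) • u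
        + (Real.sin t * inner ℝ u x + (Real.cos t - 1) * inner ℝ v x) • v) := by
  simp [planeRotation]

theorem norm_planeRotation {u v : E} (hu : ‖u‖ = 1) (hv : ‖v‖ = 1) (huv : inner ℝ u v = 0)
    (t : ℝ) (x : E) : ‖planeRotation u v t x‖ = ‖x‖ := by
  rw [← sq_eq_sq₀ (norm_nonneg _) (norm_nonneg _), planeRotation_apply, norm_add_sq_real,
    norm_add_sq_real]
  simp only [inner_add_right, inner_smul_left, inner_smul_right, norm_smul, mul_pow, hu, hv, huv,
    real_inner_comm u x, real_inner_comm v x, Real.norm_eq_abs, sq_abs]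
  have := Real.sin_sq_add_cos_sq t
  simp
  linear_combination ((inner ℝ u x) ^ 2 + (inner ℝ v x) ^ 2) * this

theorem hasDerivAt_planeRotation (u v : E) (t : ℝ) (x : E) :
    HasDerivAt (fun s => planeRotation u v s x)
      ((-Real.sin t * inner ℝ u x - Real.cos t * inner ℝ v x) • u
        + (Real.cos t * inner ℝ u x - Real.sin t * inner ℝ v x) • v) t := by
  simp only [planeRotation_apply]
  have hc := (Real.hasDerivAt_cos t).sub_const 1
  have hs := Real.hasDerivAt_sin t
  have := (((hc.mul_const (inner ℝ u x)).sub (hs.mul_const (inner ℝ v x))).smul_const u).add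
    (((hs.mul_const (inner ℝ u x)).add (hc.mul_const (inner ℝ v x))).smul_const v)
  refine (this.const_add x).congr_deriv ?_
  simp [sub_eq_add_neg]

variable [FiniteDimensional ℝ E] [MeasurableSpace E] [BorelSpace E]

theorem hausdorffMeasure_hemisphere_lt_top {d : ℕ} (hd : Module.finrank ℝ E = d + 1)
    {v : E} (hv : ‖v‖ = 1) :
    μH[(d : ℝ)] {x ∈ Metric.sphere (0 : E) 1 | inner ℝ v x ≤ 0} < ⊤ := by
  have : Fact (Module.finrank ℝ E = d + 1) := ⟨hd⟩
  have hfr : Module.finrank ℝ (Submodule.span ℝ {v})ᗮ = d :=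
    Submodule.finrank_orthogonal_span_singleton (by rintro rfl; simp at hv)
  let F : (Submodule.span ℝ {v})ᗮ → E := fun w => stereoInvFunAux v w
  have hF : ContDiff ℝ 1 F := contDiff_stereoInvFunAux.comp (Submodule.subtypeL (Submodule.span ℝ {v})ᗮ).contDiff
  obtain ⟨K, hK⟩ := hF.contDiffOn.exists_lipschitzOnWith (s := Metric.closedBall 0 2)
    one_ne_zero (convex_closedBall _ _) (isCompact_closedBall _ _)
  have hfin : μH[(d : ℝ)] (Metric.closedBall (0 : (Submodule.span ℝ {v})ᗮ) 2) < ⊤ := by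
    rw [← hfr]
    exact (isCompact_closedBall _ _).measure_lt_top
  refine (measure_mono ?_).trans_lt ((hK.hausdorffMeasure_image_le d.cast_nonneg).trans_lt
    (ENNReal.mul_lt_top (by simp) hfin))
  rintro x ⟨hx, hvx⟩
  have hx1 : ‖x‖ = 1 := by simpa using hx
  refine ⟨stereoToFun v x, ?_, ?_⟩
  · have h1 : ‖(Submodule.span ℝ {v})ᗮ.orthogonalProjectionOnto x‖ ≤ 1 :=
      hx1 ▸ Submodule.norm_orthogonalProjectionOnto_apply_le _ x
    have h2 : ‖2 / (1 - inner ℝ v x)‖ ≤ 2 := by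
      have h3 : 0 < 1 - inner ℝ v x := by linarith
      rw [Real.norm_of_nonneg (by positivity), div_le_iff₀ h3]
      linarith
    rw [mem_closedBall_zero_iff, stereoToFun_apply, norm_smul, innerSL_apply_apply]
    calc _ ≤ (2 : ℝ) * 1 := by gcongr
      _ = 2 := by norm_num
  · have hne : ((⟨x, hx⟩ : Metric.sphere (0 : E) 1) : E) ≠ v := by
      rintro rfl
      simp [hv] at hvx
      linarith
    exact congrArg Subtype.val (stereo_left_inv hv hne)

theorem hausdorffMeasure_sphere_lt_top {d : ℕ} (hd : Module.finrank ℝ E = d + 1)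
    (p : E) {r : ℝ} (hr : 0 < r) :
    μH[(d : ℝ)] (Metric.sphere p r) < ⊤ := by
  have : Nontrivial E := Module.nontrivial_of_finrank_pos (R := ℝ) (by omega)
  obtain ⟨v, hv⟩ := exists_norm_eq E zero_le_one
  have hunit : μH[(d : ℝ)] (Metric.sphere (0 : E) 1) < ⊤ := by
    refine (measure_mono ?_).trans_lt (measure_union_lt_top
      (hausdorffMeasure_hemisphere_lt_top hd hv)
      (hausdorffMeasure_hemisphere_lt_top hd (v := -v) (by simpa using hv)))
    intro x hx
    rcases le_total (inner ℝ v x) 0 with h | h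
    · exact Or.inl ⟨hx, h⟩
    · exact Or.inr ⟨hx, by simpa using h⟩
  have hL : LipschitzWith ‖r‖₊ (fun x : E => p + r • x) :=
    LipschitzWith.of_dist_le_mul fun x y => by
      rw [dist_add_left, dist_smul₀]; simp
  have him : (fun x : E => p + r • x) '' Metric.sphere 0 1 = Metric.sphere p r := by
    ext y
    constructor
    · rintro ⟨x, hx, rfl⟩
      have hx1 : ‖x‖ = 1 := by simpa using hx
      simp [norm_smul, hx1, abs_of_pos hr]
    · intro hy
      have hyr : ‖y - p‖ = r := by simpa [dist_eq_norm] using hy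
      refine ⟨r⁻¹ • (y - p), ?_, by simp [smul_inv_smul₀ hr.ne']⟩
      simp [norm_smul, hyr, abs_of_pos hr, hr.ne']
  rw [← him]
  exact (hL.hausdorffMeasure_image_le d.cast_nonneg _).trans_lt
    (ENNReal.mul_lt_top (by simp) hunit)

/-- The derivative of a `C¹` function along an infinitesimal rotation about the center of a sphere
has vanishing integral over that sphere. -/
theorem integral_sphere_fderiv_rotation_eq_zero {d : ℕ} (hd : Module.finrank ℝ E = d + 1)
    {p : E} {r : ℝ} (hr : 0 < r) {U : Set E} (hU : IsOpen U) (hUsub : Metric.sphere p r ⊆ U)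
    {f : E → ℝ} (hf : ContDiffOn ℝ 1 f U)
    {u v : E} (hu : ‖u‖ = 1) (hv : ‖v‖ = 1) (huv : inner ℝ u v = 0) :
    ∫ x in Metric.sphere p r,
      fderiv ℝ f x (inner ℝ u (x - p) • v - inner ℝ v (x - p) • u) ∂μH[(d : ℝ)] = 0 := by
  have hS : MeasurableSet (Metric.sphere p r) := Metric.isClosed_sphere.measurableSet
  have hSc : IsCompact (Metric.sphere p r) := isCompact_sphere p r
  have hfin := hausdorffMeasure_sphere_lt_top hd p hr
  have hint {g : E → ℝ} (hg : ContinuousOn g (Metric.sphere p r)) :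
      IntegrableOn g (Metric.sphere p r) μH[(d : ℝ)] :=
    hg.integrableOn_of_subset_isCompact hSc hS subset_rfl hfin.ne
  let R (t : ℝ) : E ≃ₗᵢ[ℝ] E := LinearIsometry.toLinearIsometryEquiv
    ⟨planeRotation u v t, norm_planeRotation hu hv huv t⟩ rfl
  let Φ (t : ℝ) : E ≃ᵢ E :=
    (IsometryEquiv.subRight p).trans ((R t).toIsometryEquiv.trans (IsometryEquiv.addRight p))
  have hΦ (t : ℝ) (x : E) : Φ t x = planeRotation u v t (x - p) + p := rfl
  have hpre (t : ℝ) : Φ t ⁻¹' Metric.sphere p r = Metric.sphere p r := by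
    ext x
    rw [Set.mem_preimage, mem_sphere_iff_norm, mem_sphere_iff_norm, hΦ, add_sub_cancel_right,
      norm_planeRotation hu hv huv]
  have hmem {t : ℝ} {x : E} (hx : x ∈ Metric.sphere p r) : Φ t x ∈ Metric.sphere p r := by
    rwa [← Set.mem_preimage, hpre]
  have hconst (t : ℝ) : ∫ x in Metric.sphere p r, f (Φ t x) ∂μH[(d : ℝ)]
      = ∫ x in Metric.sphere p r, f x ∂μH[(d : ℝ)] := by
    have := ((Φ t).measurePreserving_hausdorffMeasure (d : ℝ)).setIntegral_preimage_emb
      (Φ t).toHomeomorph.measurableEmbedding f (Metric.sphere p r)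
    rwa [hpre] at this
  let V (t : ℝ) (x : E) : E :=
    (-Real.sin t * inner ℝ u (x - p) - Real.cos t * inner ℝ v (x - p)) • u
        + (Real.cos t * inner ℝ u (x - p) - Real.sin t * inner ℝ v (x - p)) • v
  have hdf : ContinuousOn (fderiv ℝ f) U := hf.continuousOn_fderiv_of_isOpen hU le_rfl
  obtain ⟨M, hM⟩ := hSc.exists_bound_of_continuousOn (hdf.mono hUsub)
  have hΦd (t : ℝ) (x : E) : HasDerivAt (fun s => Φ s x) (V t x) t :=
    (hasDerivAt_planeRotation u v t (x - p)).add_const p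
  have hder {t : ℝ} {x : E} (hx : x ∈ Metric.sphere p r) :
      HasDerivAt (fun s => f (Φ s x)) (fderiv ℝ f (Φ t x) (V t x)) t := by
    have hd := (hf.contDiffAt (hU.mem_nhds (hUsub (hmem (t := t) hx)))).differentiableAt
      one_ne_zero
    exact hd.hasFDerivAt.comp_hasDerivAt t (hΦd t x)
  have hV {t : ℝ} {x : E} (hx : x ∈ Metric.sphere p r) : ‖V t x‖ ≤ 4 * r := by
    have hxr : ‖x - p‖ = r := by simpa [dist_eq_norm] using hx
    have h1 : |inner ℝ u (x - p)| ≤ r := by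
      simpa [hu, hxr] using abs_real_inner_le_norm u (x - p)
    have h2 : |inner ℝ v (x - p)| ≤ r := by
      simpa [hv, hxr] using abs_real_inner_le_norm v (x - p)
    have hc := Real.abs_cos_le_one t
    have hs := Real.abs_sin_le_one t
    have key {a b α β : ℝ} (ha : |a| ≤ 1) (hb : |b| ≤ 1) (hα : |α| ≤ r) (hβ : |β| ≤ r) :
        |a * α - b * β| ≤ 2 * r := by
      calc |a * α - b * β| ≤ |a| * |α| + |b| * |β| := by
            rw [← abs_mul, ← abs_mul]; exact abs_sub _ _
        _ ≤ 1 * r + 1 * r := by gcongr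
        _ = 2 * r := by ring
    calc ‖V t x‖ ≤ _ := norm_add_le _ _
      _ ≤ 2 * r + 2 * r := by
          simp only [norm_smul, hu, hv, mul_one, Real.norm_eq_abs]
          exact add_le_add (key (by simpa using hs) hc h1 h2) (key hc hs h1 h2)
      _ = 4 * r := by ring
  have h0 (x : E) : Φ 0 x = x := by simp [hΦ, planeRotation_apply]
  have hV0 (x : E) : V 0 x = inner ℝ u (x - p) • v - inner ℝ v (x - p) • u := by
    simp [V]; abel
  have hV0c : Continuous (V 0) := by
    simp only [funext hV0]; fun_prop
  have hD := (hasDerivAt_integral_of_dominated_loc_of_deriv_le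
    (μ := μH[(d : ℝ)].restrict (Metric.sphere p r)) (s := Set.univ) (x₀ := (0 : ℝ))
    (F := fun t x => f (Φ t x)) (F' := fun t x => fderiv ℝ f (Φ t x) (V t x))
    (bound := fun _ => M * (4 * r)) Filter.univ_mem
    (Filter.Eventually.of_forall fun t => (hint ((hf.continuousOn.mono hUsub).comp
      (Φ t).continuous.continuousOn fun x hx => hmem hx)).aestronglyMeasurable)
    (hint ((hf.continuousOn.mono hUsub).comp
      (Φ 0).continuous.continuousOn fun x hx => hmem hx))
    (by
      simp only [h0]
      exact (hint ((hdf.mono hUsub).clm_apply hV0c.continuousOn)).aestronglyMeasurable)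
    (by
      filter_upwards [ae_restrict_mem hS] with x hx t _
      exact (ContinuousLinearMap.le_opNorm _ _).trans (mul_le_mul (hM _ (hmem hx)) (hV hx)
        (norm_nonneg _) ((norm_nonneg _).trans (hM _ (hmem (t := t) hx)))))
    (hint continuousOn_const)
    (by
      filter_upwards [ae_restrict_mem hS] with x hx t _
      exact hder hx)).2
  simp only [hconst] at hD
  simpa [h0, hV0] using hD.unique (hasDerivAt_const _ _)

end

theorem integrableOn_sphere {n : ℕ} (hn : 1 ≤ n) {p : EuclideanSpace ℝ (Fin n)} {r : ℝ}
    (hr : 0 < r) {g : EuclideanSpace ℝ (Fin n) → ℝ} (hg : ContinuousOn g (Metric.sphere p r)) :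
    IntegrableOn g (Metric.sphere p r) μH[(n : ℝ) - 1] := by
  refine hg.integrableOn_of_subset_isCompact (isCompact_sphere p r)
    Metric.isClosed_sphere.measurableSet subset_rfl ?_
  have := hausdorffMeasure_sphere_lt_top (d := n - 1) (by simp; omega) p hr
  rw [Nat.cast_sub hn, Nat.cast_one] at this
  exact this.ne

theorem continuousOn_fderiv_apply {E : Type*} [NormedAddCommGroup E] [NormedSpace ℝ E]
    {U S : Set E} (hU : IsOpen U) (hS : S ⊆ U) {f : E → ℝ} (hf : ContDiffOn ℝ 1 f U) (w : E) :
    ContinuousOn (fun x => fderiv ℝ f x w) S :=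
  ((hf.continuousOn_fderiv_of_isOpen hU le_rfl).mono hS).clm_apply continuousOn_const

theorem integral_sphere_angular_deriv_eq_zero {n : ℕ} (hn : 1 ≤ n)
    {p : EuclideanSpace ℝ (Fin n)} {r : ℝ} (hr : 0 < r)
    {U : Set (EuclideanSpace ℝ (Fin n))} (hU : IsOpen U) (hUsub : Metric.sphere p r ⊆ U)
    {f : EuclideanSpace ℝ (Fin n) → ℝ} (hf : ContDiffOn ℝ 1 f U) (a b : Fin n) :
    ∫ x in Metric.sphere p r,
      ((x a - p a) * fderiv ℝ f x (EuclideanSpace.single b 1)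
        - (x b - p b) * fderiv ℝ f x (EuclideanSpace.single a 1)) ∂μH[(n : ℝ) - 1] = 0 := by
  rcases eq_or_ne a b with rfl | hab
  · simp
  have := integral_sphere_fderiv_rotation_eq_zero (d := n - 1) (by simp; omega) hr hU hUsub hf
    (u := EuclideanSpace.single a (1 : ℝ)) (v := EuclideanSpace.single b (1 : ℝ))
    (by simp) (by simp) (by simp [EuclideanSpace.inner_single_left, hab])
  rw [Nat.cast_sub hn, Nat.cast_one] at this
  simpa [EuclideanSpace.inner_single_left] using this

/-- The tangential divergence theorem on a sphere, for a vector field `f eₐ`. -/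
theorem integral_sphere_tangential_deriv_eq_zero {n : ℕ} (hn : 1 ≤ n)
    {p : EuclideanSpace ℝ (Fin n)} {r : ℝ} (hr : 0 < r)
    {U : Set (EuclideanSpace ℝ (Fin n))} (hU : IsOpen U) (hUsub : Metric.sphere p r ⊆ U)
    {f : EuclideanSpace ℝ (Fin n) → ℝ} (hf : ContDiffOn ℝ 1 f U) (a : Fin n) :
    ∫ x in Metric.sphere p r,
      (r ^ 2 * fderiv ℝ f x (EuclideanSpace.single a 1)
        - (x a - p a) * ∑ b, (x b - p b) * fderiv ℝ f x (EuclideanSpace.single b 1)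
        - ((n : ℝ) - 1) * (x a - p a) * f x) ∂μH[(n : ℝ) - 1] = 0 := by
  have hc (b : Fin n) : ContDiff ℝ 1 fun x : EuclideanSpace ℝ (Fin n) => x b - p b := by
    fun_prop
  have hg (b : Fin n) : ContDiffOn ℝ 1 (fun x => f x * (x b - p b)) U :=
    hf.mul (hc b).contDiffOn
  have hz := Finset.sum_eq_zero fun b (_ : b ∈ Finset.univ) =>
    integral_sphere_angular_deriv_eq_zero hn hr hU hUsub (hg b) b a
  rw [← integral_finsetSum] at hz
  · rw [← hz]
    refine setIntegral_congr_fun Metric.isClosed_sphere.measurableSet fun x hx => ?_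
    have hfx : DifferentiableAt ℝ f x :=
      (hf.contDiffAt (hU.mem_nhds (hUsub hx))).differentiableAt one_ne_zero
    have hfd (b c : Fin n) :
        fderiv ℝ (fun x => f x * (x b - p b)) x (EuclideanSpace.single c 1)
          = f x * (if b = c then 1 else 0)
            + (x b - p b) * fderiv ℝ f x (EuclideanSpace.single c 1) := by
      have hcb : HasFDerivAt (fun x : EuclideanSpace ℝ (Fin n) => x b - p b)
          (EuclideanSpace.proj b : EuclideanSpace ℝ (Fin n) →L[ℝ] ℝ) x :=
        (EuclideanSpace.proj (𝕜 := ℝ) b).hasFDerivAt.sub_const _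
      rw [(hfx.hasFDerivAt.fun_mul hcb).fderiv]
      simp
    have hsq : ∑ b, (x b - p b) ^ 2 = r ^ 2 := by
      have hxr : ‖x - p‖ = r := by simpa [dist_eq_norm] using hx
      rw [← hxr, EuclideanSpace.real_norm_sq_eq]
      simp
    have ha : ∑ b, (x b - p b) * (if b = a then 1 else 0) = x a - p a := by simp
    have hcard : ∑ _b : Fin n, (x a - p a) * f x = n * ((x a - p a) * f x) := by simp
    simp only [hfd, if_true]
    calc _ = f x * ∑ b, (x b - p b) * (if b = a then 1 else 0)
          + fderiv ℝ f x (EuclideanSpace.single a 1) * ∑ b, (x b - p b) ^ 2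
          - ∑ _b : Fin n, (x a - p a) * f x
          - (x a - p a) * ∑ b, (x b - p b) * fderiv ℝ f x (EuclideanSpace.single b 1) := by
          rw [ha, hcard, hsq]; ring
      _ = _ := by
          rw [Finset.mul_sum, Finset.mul_sum, Finset.mul_sum, ← Finset.sum_add_distrib,
            ← Finset.sum_sub_distrib, ← Finset.sum_sub_distrib]
          exact Finset.sum_congr rfl fun b _ => by ring
  · intro b _
    have h1 := fun c => continuousOn_fderiv_apply hU hUsub (hg b) (EuclideanSpace.single c 1)
    exact integrableOn_sphere hn hr (((hc b).continuous.continuousOn.mul (h1 a)).sub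
      ((hc a).continuous.continuousOn.mul (h1 b)))

theorem sphere_coordinate_identity {n : ℕ} {r : ℝ} (hr : r ≠ 0) (h : Fin n → Fin n → ℝ)
    (D : Fin n → Fin n → Fin n → ℝ) (y : Fin n → ℝ) (l : Fin n) :
    r ^ 3 * (((∑ i, h i l * (y i / r))
          + y l * ((∑ i, h i i) / r
              - ((n : ℝ) + 1) / r * ∑ i, ∑ j, h i j * (y i / r) * (y j / r)
              + ∑ i, ∑ j, D i j j * (y i / r)))
        - y l * ∑ i, ∑ j, ∑ k, D i j k * (y i / r) * (y j / r) * (y k / r))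
      = ∑ j, (r ^ 2 * ((if l = j then ∑ i, h i j * y i else 0)
            + y l * (h j j + ∑ i, y i * D i j j))
          - y j * ∑ b, y b * ((if l = b then ∑ i, h i j * y i else 0)
            + y l * (h b j + ∑ i, y i * D i j b))
          - ((n : ℝ) - 1) * y j * (y l * ∑ i, h i j * y i)) := by
  have e1 : ∑ i, h i l * (y i / r) = (∑ i, h i l * y i) / r := by
    simp only [Finset.sum_div, mul_div_assoc]
  have e2 : ∑ i, ∑ j, h i j * (y i / r) * (y j / r) = (∑ i, ∑ j, h i j * y i * y j) / r ^ 2 := by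
    simp only [Finset.sum_div]
    refine Finset.sum_congr rfl fun i _ => Finset.sum_congr rfl fun j _ => ?_
    field_simp
  have e3 : ∑ i, ∑ j, D i j j * (y i / r) = (∑ i, ∑ j, D i j j * y i) / r := by
    simp only [Finset.sum_div, mul_div_assoc]
  have e4 : ∑ i, ∑ j, ∑ k, D i j k * (y i / r) * (y j / r) * (y k / r)
      = (∑ i, ∑ j, ∑ k, D i j k * y i * y j * y k) / r ^ 3 := by
    simp only [Finset.sum_div]
    refine Finset.sum_congr rfl fun i _ => Finset.sum_congr rfl fun j _ =>
      Finset.sum_congr rfl fun k _ => ?_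
    field_simp
  have f1 : ∑ j, (if l = j then ∑ i, h i j * y i else 0) = ∑ i, h i l * y i := by simp
  have f2 : ∑ j, ∑ i, y i * D i j j = ∑ i, ∑ j, D i j j * y i := by
    rw [Finset.sum_comm]
    simp only [mul_comm]
  have f3 (j : Fin n) : ∑ b, y b * ((if l = b then ∑ i, h i j * y i else 0)
      + y l * (h b j + ∑ i, y i * D i j b))
      = y l * (2 * ∑ i, h i j * y i) + y l * ∑ i, ∑ k, y i * D i j k * y k := by
    have hD : ∑ i, ∑ k, y i * D i j k * y k = ∑ b, y b * ∑ i, y i * D i j b := by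
      rw [Finset.sum_comm]
      simp only [Finset.mul_sum, mul_comm]
    have hl : ∑ b, y b * (if l = b then ∑ i, h i j * y i else 0)
        = y l * ∑ i, h i j * y i := by simp
    calc _ = ∑ b, y b * (if l = b then ∑ i, h i j * y i else 0)
          + y l * ∑ b, h b j * y b + y l * ∑ b, y b * ∑ i, y i * D i j b := by
          rw [Finset.mul_sum, Finset.mul_sum, ← Finset.sum_add_distrib, ← Finset.sum_add_distrib]
          exact Finset.sum_congr rfl fun b _ => by ring
      _ = _ := by rw [hl, hD]; ring
  have f4 : ∑ j, y j * ∑ i, h i j * y i = ∑ i, ∑ j, h i j * y i * y j := by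
    rw [Finset.sum_comm]
    simp only [Finset.mul_sum, mul_comm]
  have f5 : ∑ j, y j * ∑ i, ∑ k, y i * D i j k * y k
      = ∑ i, ∑ j, ∑ k, D i j k * y i * y j * y k := by
    rw [Finset.sum_comm]
    simp only [Finset.mul_sum]
    refine Finset.sum_congr rfl fun i _ => Finset.sum_congr rfl fun j _ =>
      Finset.sum_congr rfl fun k _ => ?_
    ring
  have f6 : ∑ j, (r ^ 2 * ((if l = j then ∑ i, h i j * y i else 0)
            + y l * (h j j + ∑ i, y i * D i j j))
          - y j * ∑ b, y b * ((if l = b then ∑ i, h i j * y i else 0)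
            + y l * (h b j + ∑ i, y i * D i j b))
          - ((n : ℝ) - 1) * y j * (y l * ∑ i, h i j * y i))
      = r ^ 2 * ∑ j, (if l = j then ∑ i, h i j * y i else 0) + r ^ 2 * y l * ∑ j, h j j
        + r ^ 2 * y l * ∑ j, ∑ i, y i * D i j j
        - ((n : ℝ) + 1) * y l * ∑ j, y j * ∑ i, h i j * y i
        - y l * ∑ j, y j * ∑ i, ∑ k, y i * D i j k * y k := by
    rw [Finset.mul_sum, Finset.mul_sum, Finset.mul_sum, Finset.mul_sum, Finset.mul_sum,
      ← Finset.sum_add_distrib, ← Finset.sum_add_distrib, ← Finset.sum_sub_distrib,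
      ← Finset.sum_sub_distrib]
    refine Finset.sum_congr rfl fun j _ => ?_
    rw [f3]
    ring
  rw [f6, f1, f2, f4, f5, e1, e2, e3, e4]
  field_simp
  ring

/-- Integration-by-parts identity on Euclidean spheres used in the derivation of the
alternative expression for the center of mass. -/
theorem sphere_integration_by_parts (n : ℕ) (hn : 3 ≤ n)
    (p : EuclideanSpace ℝ (Fin n)) (r : ℝ) (hr : 0 < r)
    (h : Fin n → Fin n → EuclideanSpace ℝ (Fin n) → ℝ)
    (U : Set (EuclideanSpace ℝ (Fin n))) (hU : IsOpen U)
    (hUsub : Metric.sphere p r ⊆ U)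
    (hC1 : ∀ i j, ContDiffOn ℝ 1 (h i j) U)
    (l : Fin n) :
    (∫ x in Metric.sphere p r,
        (x l - p l) * ∑ i : Fin n, ∑ j : Fin n, ∑ k : Fin n,
          fderiv ℝ (h i j) x (EuclideanSpace.single k 1)
            * ((x i - p i) / r) * ((x j - p j) / r) * ((x k - p k) / r)
        ∂μH[((n : ℝ) - 1)])
      =
    ∫ x in Metric.sphere p r,
        ((∑ i : Fin n, h i l x * ((x i - p i) / r))
          + (x l - p l) *
            ((∑ i : Fin n, h i i x) / r
              - ((n : ℝ) + 1) / r * ∑ i : Fin n, ∑ j : Fin n,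
                  h i j x * ((x i - p i) / r) * ((x j - p j) / r)
              + ∑ i : Fin n, ∑ j : Fin n,
                  fderiv ℝ (h i j) x (EuclideanSpace.single j 1) * ((x i - p i) / r)))
        ∂μH[((n : ℝ) - 1)] := by
  have hn1 : 1 ≤ n := by omega
  have hc (b : Fin n) : ContDiff ℝ 1 fun x : EuclideanSpace ℝ (Fin n) => x b - p b := by
    fun_prop
  have hg (j : Fin n) :
      ContDiffOn ℝ 1 (fun x => (x l - p l) * ∑ i, h i j x * (x i - p i)) U :=
    (hc l).contDiffOn.mul (ContDiffOn.sum fun i _ => (hC1 i j).mul (hc i).contDiffOn)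
  have hcont (i j : Fin n) : ContinuousOn (h i j) (Metric.sphere p r) :=
    (hC1 i j).continuousOn.mono hUsub
  have hcontd (i j k : Fin n) := continuousOn_fderiv_apply hU hUsub (hC1 i j)
    (EuclideanSpace.single k 1)
  rw [eq_comm, ← sub_eq_zero, ← integral_sub (integrableOn_sphere hn1 hr (by fun_prop))
    (integrableOn_sphere hn1 hr (by fun_prop))]
  have hz := Finset.sum_eq_zero fun j (_ : j ∈ Finset.univ) =>
    integral_sphere_tangential_deriv_eq_zero hn1 hr hU hUsub (hg j) j
  rw [← integral_finsetSum] at hz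
  · rw [← mul_right_inj' (pow_ne_zero 3 hr.ne'), mul_zero, ← hz, ← integral_const_mul]
    refine setIntegral_congr_fun Metric.isClosed_sphere.measurableSet fun x hx => ?_
    have hfd (j b : Fin n) :
        fderiv ℝ (fun x => (x l - p l) * ∑ i, h i j x * (x i - p i)) x (EuclideanSpace.single b 1)
          = (if l = b then ∑ i, h i j x * (x i - p i) else 0)
            + (x l - p l) * (h b j x
              + ∑ i, (x i - p i) * fderiv ℝ (h i j) x (EuclideanSpace.single b 1)) := by
      have hcb (c : Fin n) : HasFDerivAt (fun x : EuclideanSpace ℝ (Fin n) => x c - p c)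
          (EuclideanSpace.proj c : EuclideanSpace ℝ (Fin n) →L[ℝ] ℝ) x :=
        (EuclideanSpace.proj (𝕜 := ℝ) c).hasFDerivAt.sub_const _
      have hhd (i : Fin n) : HasFDerivAt (h i j) (fderiv ℝ (h i j) x) x :=
        (((hC1 i j).contDiffAt (hU.mem_nhds (hUsub hx))).differentiableAt
          one_ne_zero).hasFDerivAt
      rw [((hcb l).fun_mul (HasFDerivAt.fun_sum fun i (_ : i ∈ Finset.univ) =>
        (hhd i).fun_mul (hcb i))).fderiv]
      simp [Finset.sum_add_distrib]
      ring
    simp only [hfd]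
    exact sphere_coordinate_identity hr.ne' (fun i j => h i j x)
      (fun i j k => fderiv ℝ (h i j) x (EuclideanSpace.single k 1)) (fun i => x i - p i) l
  · intro j _
    have h1 := fun c => continuousOn_fderiv_apply hU hUsub (hg j) (EuclideanSpace.single c 1)
    have h2 := (hg j).continuousOn.mono hUsub
    exact integrableOn_sphere hn1 hr (by fun_prop)
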